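/- Let n ≥ 3 and σ₂ ∈ C_c^∞(ℝ^n) be radially symmetric, and q(t) = (2π)^{-n} ∫_{ℝ^n} (sin(t|ξ|)/|ξ|) |σ̂₂(ξ)|² dξ. Then ∫_0^∞ q(t) dt = (2π)^{-n} ∫_{ℝ^n} |σ̂₂(ξ)|²/|ξ|² dξ, and this quantity κ is finite and strictly positive (provided σ₂ ≢ 0). -/

import Mathlib

open MeasureTheory Real Filter
open scoped RealInnerProductSpace ENNReal NNReal

noncomputable section

abbrev Ed (d : ℕ) := EuclideanSpace ℝ (Fin d)

/-- The Fourier transform (unnormalized convention) of a real function on `ℝ^n`. -/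
def ftransform {n : ℕ} (σ : Ed n → ℝ) (ξ : Ed n) : ℂ :=
  ∫ y : Ed n, Complex.exp (-(⟪y, ξ⟫ : ℝ) * Complex.I) * (σ y : ℂ)

open scoped SchwartzMap FourierTransform

lemma SchwartzMap.tendsto_atTop_zero (f : 𝓢(ℝ, ℝ)) : Tendsto f atTop (nhds 0) :=
  (zero_at_infty f.toZeroAtInfty).mono_left atTop_le_cocompact

lemma norm_mul_le_of_abs_le_one {a b : ℝ} (ha : |a| ≤ 1) : ‖a * b‖ ≤ ‖b‖ := by
  rw [norm_mul]
  exact mul_le_of_le_one_left (norm_nonneg _) ha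

lemma SchwartzMap.integrable_cos_mul (f : 𝓢(ℝ, ℝ)) (t : ℝ) :
    Integrable (fun r => cos (t * r) * f r) :=
  f.integrable.norm.mono' (by have := f.continuous; fun_prop)
    (ae_of_all _ fun _ => norm_mul_le_of_abs_le_one (abs_cos_le_one _))

lemma SchwartzMap.integrable_sin_mul (f : 𝓢(ℝ, ℝ)) (t : ℝ) :
    Integrable (fun r => sin (t * r) * f r) :=
  f.integrable.norm.mono' (by have := f.continuous; fun_prop)
    (ae_of_all _ fun _ => norm_mul_le_of_abs_le_one (abs_sin_le_one _))

lemma SchwartzMap.norm_integral_sin_mul_le (f : 𝓢(ℝ, ℝ)) (t : ℝ) :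
    ‖∫ r in Set.Ioi (0 : ℝ), sin (t * r) * f r‖ ≤ ∫ r in Set.Ioi (0 : ℝ), ‖f r‖ :=
  norm_integral_le_of_norm_le f.integrable.norm.integrableOn
    (ae_of_all _ fun _ => norm_mul_le_of_abs_le_one (abs_sin_le_one _))

lemma SchwartzMap.hasDerivAt_derivCLM (f : 𝓢(ℝ, ℝ)) (x : ℝ) :
    HasDerivAt f (derivCLM ℝ ℝ f x) x := by
  rw [derivCLM_apply]
  exact f.differentiableAt.hasDerivAt

lemma SchwartzMap.integral_cos_mul_eq (f : 𝓢(ℝ, ℝ)) (t : ℝ) :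
    t * ∫ r in Set.Ioi (0 : ℝ), cos (t * r) * f r =
      -∫ r in Set.Ioi (0 : ℝ), sin (t * r) * derivCLM ℝ ℝ f r := by
  have hd : ∀ x : ℝ, HasDerivAt (fun r => sin (t * r)) (t * cos (t * x)) x := fun x => by
    simpa [mul_comm] using ((hasDerivAt_id x).const_mul t).sin
  have key := integral_Ioi_deriv_mul_eq_sub (a := 0) (a' := 0) (b' := 0)
    (fun x _ => hd x) (fun x _ => f.hasDerivAt_derivCLM x)
    (((((f.integrable_cos_mul t).const_mul t).add
      ((derivCLM ℝ ℝ f).integrable_sin_mul t)).congr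
        (ae_of_all _ fun x => by simp [mul_assoc])).integrableOn)
    (by
      have hc : Continuous ((fun r => sin (t * r)) * ⇑f) := by
        have := f.continuous
        fun_prop
      simpa using (hc.tendsto 0).mono_left nhdsWithin_le_nhds)
    (squeeze_zero_norm (fun r => norm_mul_le_of_abs_le_one (abs_sin_le_one _))
      (by simpa using f.tendsto_atTop_zero.norm))
  simp_rw [mul_assoc] at key
  rw [integral_add ((f.integrable_cos_mul t).const_mul t).integrableOn
    ((derivCLM ℝ ℝ f).integrable_sin_mul t).integrableOn, integral_const_mul] at key
  linarith

lemma SchwartzMap.integral_sin_mul_eq (f : 𝓢(ℝ, ℝ)) (hf : f 0 = 0) (t : ℝ) :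
    t * ∫ r in Set.Ioi (0 : ℝ), sin (t * r) * f r =
      ∫ r in Set.Ioi (0 : ℝ), cos (t * r) * derivCLM ℝ ℝ f r := by
  have hd : ∀ x : ℝ, HasDerivAt (fun r => cos (t * r)) (-t * sin (t * x)) x := fun x => by
    simpa [mul_comm] using ((hasDerivAt_id x).const_mul t).cos
  have key := integral_Ioi_deriv_mul_eq_sub (a := 0) (a' := 0) (b' := 0)
    (fun x _ => hd x) (fun x _ => f.hasDerivAt_derivCLM x)
    (((((f.integrable_sin_mul t).const_mul (-t)).add
      ((derivCLM ℝ ℝ f).integrable_cos_mul t)).congr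
        (ae_of_all _ fun x => by simp [mul_assoc])).integrableOn)
    (by
      have hc : Continuous ((fun r => cos (t * r)) * ⇑f) := by
        have := f.continuous
        fun_prop
      simpa [hf] using (hc.tendsto 0).mono_left nhdsWithin_le_nhds)
    (squeeze_zero_norm (fun r => norm_mul_le_of_abs_le_one (abs_cos_le_one _))
      (by simpa using f.tendsto_atTop_zero.norm))
  simp_rw [mul_assoc] at key
  rw [integral_add ((f.integrable_sin_mul t).const_mul (-t)).integrableOn
    ((derivCLM ℝ ℝ f).integrable_cos_mul t).integrableOn, integral_const_mul] at key
  linarith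

lemma SchwartzMap.hasDerivAt_integral_cos_mul (k h : 𝓢(ℝ, ℝ)) (hkh : ∀ r, h r = r * k r)
    (t : ℝ) :
    HasDerivAt (fun s => ∫ r in Set.Ioi (0 : ℝ), cos (s * r) * k r)
      (-∫ r in Set.Ioi (0 : ℝ), sin (t * r) * h r) t := by
  rw [← integral_neg]
  refine (hasDerivAt_integral_of_dominated_loc_of_deriv_le (s := Set.univ)
    (F' := fun s r => -(sin (s * r) * h r)) (bound := fun r => ‖h r‖) Filter.univ_mem
    (Eventually.of_forall fun s => (k.integrable_cos_mul s).integrableOn.aestronglyMeasurable)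
    (k.integrable_cos_mul t).integrableOn
    (h.integrable_sin_mul t).neg.integrableOn.aestronglyMeasurable
    (ae_of_all _ fun r s _ => ?_) h.integrable.norm.integrableOn
    (ae_of_all _ fun r s _ => ?_)).2
  · rw [norm_neg]
    exact norm_mul_le_of_abs_le_one (abs_sin_le_one _)
  · have := (((hasDerivAt_id s).mul_const r).cos).mul_const (k r)
    simpa [hkh, mul_assoc] using this

/-- The sine transform over the half-line of a Schwartz function vanishing at `0` is
integrable. -/
lemma SchwartzMap.integrableOn_integral_sin_mul (h : 𝓢(ℝ, ℝ)) (h0 : h 0 = 0) :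
    IntegrableOn (fun t => ∫ r in Set.Ioi (0 : ℝ), sin (t * r) * h r) (Set.Ici 0) := by
  have hcont : Continuous fun t => ∫ r in Set.Ioi (0 : ℝ), sin (t * r) * h r :=
    continuous_of_dominated (bound := fun r => ‖h r‖)
      (fun t => (h.integrable_sin_mul t).integrableOn.aestronglyMeasurable)
      (fun t => ae_of_all _ fun r => norm_mul_le_of_abs_le_one (abs_sin_le_one _))
      h.integrable.norm.integrableOn (ae_of_all _ fun r => by fun_prop)
  set B := ∫ r in Set.Ioi (0 : ℝ), ‖derivCLM ℝ ℝ (derivCLM ℝ ℝ h) r‖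
  have hbound : ∀ t ∈ Set.Ioi (1 : ℝ),
      ‖∫ r in Set.Ioi (0 : ℝ), sin (t * r) * h r‖ ≤ B * t ^ (-2 : ℝ) := by
    intro t (ht : 1 < t)
    have ht0 : 0 < t := by linarith
    have h1 : t ^ 2 * ∫ r in Set.Ioi (0 : ℝ), sin (t * r) * h r =
        -∫ r in Set.Ioi (0 : ℝ), sin (t * r) * derivCLM ℝ ℝ (derivCLM ℝ ℝ h) r := by
      rw [← integral_cos_mul_eq, ← h.integral_sin_mul_eq h0]
      ring
    have h2 := (derivCLM ℝ ℝ (derivCLM ℝ ℝ h)).norm_integral_sin_mul_le t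
    rw [← norm_neg, ← h1, norm_mul, norm_of_nonneg (by positivity : 0 ≤ t ^ 2)] at h2
    rw [rpow_neg ht0.le, ← div_eq_mul_inv, le_div_iff₀ (by positivity)]
    norm_cast
    linarith
  have hI : IntegrableOn (fun t => ∫ r in Set.Ioi (0 : ℝ), sin (t * r) * h r) (Set.Ioi 1) :=
    ((integrableOn_Ioi_rpow_of_lt (by norm_num) one_pos).const_mul B).mono'
      hcont.aestronglyMeasurable ((ae_restrict_iff' measurableSet_Ioi).2 (ae_of_all _ hbound))
  rw [← Set.Icc_union_Ioi_eq_Ici zero_le_one]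
  exact hcont.continuousOn.integrableOn_Icc.union hI

/-- Abel-type formula: integrating the sine transform of `r ↦ r * k r` over the half-line
recovers the integral of `k`. -/
lemma SchwartzMap.integral_integral_sin_mul (k h : 𝓢(ℝ, ℝ)) (hkh : ∀ r, h r = r * k r) :
    ∫ t in Set.Ici (0 : ℝ), ∫ r in Set.Ioi (0 : ℝ), sin (t * r) * h r =
      ∫ r in Set.Ioi (0 : ℝ), k r := by
  have hlim : Tendsto (fun t => ∫ r in Set.Ioi (0 : ℝ), cos (t * r) * k r) atTop (nhds 0) := by
    set B := ∫ r in Set.Ioi (0 : ℝ), ‖derivCLM ℝ ℝ k r‖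
    refine squeeze_zero_norm' (a := fun t => B / t) ?_ (tendsto_const_nhds.div_atTop tendsto_id)
    filter_upwards [eventually_gt_atTop 0] with t ht
    have h2 := (derivCLM ℝ ℝ k).norm_integral_sin_mul_le t
    rw [← norm_neg, ← integral_cos_mul_eq, norm_mul, norm_of_nonneg ht.le] at h2
    rw [le_div_iff₀ ht]
    linarith
  have hint := (h.integrableOn_integral_sin_mul (by simp [hkh])).mono_set Set.Ioi_subset_Ici_self
  have key := integral_Ioi_of_hasDerivAt_of_tendsto'
    (fun t _ => k.hasDerivAt_integral_cos_mul h hkh t) hint.neg hlim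
  rw [integral_neg] at key
  rw [integral_Ici_eq_integral_Ioi]
  simpa using key

lemma SchwartzMap.exists_pow_mul (f : 𝓢(ℝ, ℝ)) (m : ℕ) :
    ∃ g : 𝓢(ℝ, ℝ), ∀ r, g r = r ^ m * f r :=
  ⟨smulLeftCLM ℝ (fun r : ℝ => r ^ m) f, fun r => by
    rw [smulLeftCLM_apply_apply (by fun_prop), smul_eq_mul]⟩

lemma ftransform_eq_fourier {n : ℕ} (σ : Ed n → ℝ) (ξ : Ed n) :
    ftransform σ ξ = 𝓕 (fun y => (σ y : ℂ)) ((2 * π)⁻¹ • ξ) := by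
  rw [ftransform, Real.fourier_eq']
  congr 1 with y
  rw [inner_smul_right, smul_eq_mul]
  congr 3
  push_cast
  have : (π : ℂ) ≠ 0 := by exact_mod_cast pi_ne_zero
  field_simp

lemma exists_schwartzMap_eq_ftransform {n : ℕ} {σ : Ed n → ℝ} (hσ : ContDiff ℝ (⊤ : ℕ∞) σ)
    (hσc : HasCompactSupport σ) :
    ∃ ψ : 𝓢(Ed n, ℂ), (∀ ξ, ψ ξ = ftransform σ ξ) ∧ (ψ = 0 → σ = 0) := by
  have hc : HasCompactSupport fun y => (σ y : ℂ) :=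
    hσc.comp_left (g := fun x : ℝ => (x : ℂ)) Complex.ofReal_zero
  let f : 𝓢(Ed n, ℂ) := hc.toSchwartzMap (Complex.ofRealCLM.contDiff.comp hσ)
  have hu : (2 * π)⁻¹ ≠ 0 := by positivity
  let L : Ed n ≃L[ℝ] Ed n := ContinuousLinearEquiv.smulLeft (Units.mk0 _ hu)
  have hL : ∀ ξ, SchwartzMap.compCLMOfContinuousLinearEquiv ℝ L (𝓕 f) ξ = ftransform σ ξ :=
    fun ξ => (ftransform_eq_fourier σ ξ).symm
  refine ⟨SchwartzMap.compCLMOfContinuousLinearEquiv ℝ L (𝓕 f), hL, fun h0 => ?_⟩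
  have hF : 𝓕 f = 0 := by
    ext ξ
    have := DFunLike.congr_fun h0 (L.symm ξ)
    simpa using this
  have hf : f = 0 := by
    rw [← FourierTransform.fourierInv_fourier_eq (F := 𝓢(Ed n, ℂ)) f, hF]
    exact map_zero (FourierTransform.fourierInvCLM ℂ 𝓢(Ed n, ℂ))
  ext y
  have := DFunLike.congr_fun hf y
  exact Complex.ofReal_eq_zero.1 this

lemma ftransform_linearIsometryEquiv {n : ℕ} {σ : Ed n → ℝ} (A : Ed n ≃ₗᵢ[ℝ] Ed n)
    (hσ : ∀ y, σ (A y) = σ y) (ξ : Ed n) : ftransform σ (A ξ) = ftransform σ ξ := by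
  unfold ftransform
  rw [← A.measurePreserving.integral_comp A.toHomeomorph.measurableEmbedding]
  simp [hσ]

lemma ftransform_eq_of_norm_eq {n : ℕ} {σ : Ed n → ℝ}
    (hrad : ∀ y y' : Ed n, ‖y‖ = ‖y'‖ → σ y = σ y') {ξ η : Ed n} (h : ‖ξ‖ = ‖η‖) :
    ftransform σ ξ = ftransform σ η := by
  rw [← Submodule.reflection_sub h]
  exact (ftransform_linearIsometryEquiv _ (fun y => hrad _ _ (LinearIsometryEquiv.norm_map _ y))
    ξ).symm

/-- The squared modulus of the Fourier transform of a radial test function is a Schwartz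
profile evaluated at the norm. -/
lemma exists_schwartzMap_normSq_ftransform {n : ℕ} (hn : 0 < n) {σ : Ed n → ℝ}
    (hσ : ContDiff ℝ (⊤ : ℕ∞) σ) (hσc : HasCompactSupport σ)
    (hrad : ∀ y y' : Ed n, ‖y‖ = ‖y'‖ → σ y = σ y') :
    ∃ G : 𝓢(ℝ, ℝ), ∀ ξ, ‖ftransform σ ξ‖ ^ 2 = G ‖ξ‖ := by
  obtain ⟨ψ, hψ, -⟩ := exists_schwartzMap_eq_ftransform hσ hσc
  let e : Ed n := EuclideanSpace.single ⟨0, hn⟩ 1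
  have he : ‖e‖ = 1 := by simp [e]
  let J := LinearIsometry.toSpanSingleton ℝ (Ed n) he
  let φ : 𝓢(ℝ, ℂ) := SchwartzMap.compCLMOfAntilipschitz ℝ
    J.toContinuousLinearMap.hasTemperateGrowth J.antilipschitz ψ
  refine ⟨SchwartzMap.pairing (innerSL ℝ : ℂ →L[ℝ] ℂ →L[ℝ] ℝ) φ φ, fun ξ => ?_⟩
  have h1 : φ ‖ξ‖ = ftransform σ ξ := by
    change ψ (J ‖ξ‖) = _
    rw [hψ]
    exact ftransform_eq_of_norm_eq hrad (by simp)
  rw [SchwartzMap.pairing_apply_apply, innerSL_apply_apply, real_inner_self_eq_norm_sq, h1]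

/-- for `n ≥ 3` and radially symmetric `σ₂ ∈ C_c^∞(ℝ^n)`, with
`q(t) = (2π)^{-n} ∫ (sin(t|ξ|)/|ξ|) |σ̂₂(ξ)|² dξ`, one has
`∫_0^∞ q = (2π)^{-n} ∫ |σ̂₂(ξ)|²/|ξ|² dξ =: κ`, a finite quantity which is
strictly positive provided `σ₂ ≢ 0`. -/
theorem stmt2 {n : ℕ} (hn : 3 ≤ n)
    (σ₂ : Ed n → ℝ) (hσ₂ : ContDiff ℝ (⊤ : ℕ∞) σ₂) (hσ₂c : HasCompactSupport σ₂)
    (hrad : ∀ y y' : Ed n, ‖y‖ = ‖y'‖ → σ₂ y = σ₂ y')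
    (q : ℝ → ℝ)
    (hq : ∀ t, q t = (2 * Real.pi) ^ (-(n : ℝ)) *
      ∫ ξ : Ed n, (Real.sin (t * ‖ξ‖) / ‖ξ‖) * ‖ftransform σ₂ ξ‖ ^ 2) :
    Integrable (fun ξ : Ed n => ‖ftransform σ₂ ξ‖ ^ 2 / ‖ξ‖ ^ 2) ∧
    IntegrableOn q (Set.Ici 0) ∧
    (∫ t in Set.Ici (0 : ℝ), q t) =
      (2 * Real.pi) ^ (-(n : ℝ)) * ∫ ξ : Ed n, ‖ftransform σ₂ ξ‖ ^ 2 / ‖ξ‖ ^ 2 ∧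
    (σ₂ ≠ 0 →
      0 < (2 * Real.pi) ^ (-(n : ℝ)) * ∫ ξ : Ed n, ‖ftransform σ₂ ξ‖ ^ 2 / ‖ξ‖ ^ 2) := by
  have hn0 : 0 < n := by omega
  have : Nonempty (Fin n) := ⟨⟨0, hn0⟩⟩
  obtain ⟨G, hG⟩ := exists_schwartzMap_normSq_ftransform hn0 hσ₂ hσ₂c hrad
  obtain ⟨k, hk⟩ := G.exists_pow_mul (n - 3)
  obtain ⟨h, hh⟩ := k.exists_pow_mul 1
  have hkh : ∀ r, h r = r * k r := by simpa using hh
  obtain ⟨m, rfl⟩ := Nat.exists_eq_add_of_le' hn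
  have hdim : Module.finrank ℝ (Ed (m + 3)) - 1 = m + 2 := by simp
  simp only [Nat.add_sub_cancel] at hk
  have hkeq : ∀ r ∈ Set.Ioi (0 : ℝ), r ^ (m + 2) • (G r / r ^ 2) = k r := by
    intro r (hr : 0 < r)
    rw [hk, smul_eq_mul]
    field_simp
    ring
  have hint : Integrable fun ξ : Ed (m + 3) => ‖ftransform σ₂ ξ‖ ^ 2 / ‖ξ‖ ^ 2 := by
    simp_rw [hG]
    refine (integrable_fun_norm_addHaar volume (f := fun r => G r / r ^ 2)).2 ?_
    rw [hdim]
    exact k.integrable.integrableOn.congr_fun (fun r hr => (hkeq r hr).symm) measurableSet_Ioi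
  set D : ℝ := (m + 3 : ℕ) * (volume : Measure (Ed (m + 3))).real (Metric.ball 0 1)
  have hκ : ∫ ξ : Ed (m + 3), ‖ftransform σ₂ ξ‖ ^ 2 / ‖ξ‖ ^ 2 =
      D * ∫ r in Set.Ioi (0 : ℝ), k r := by
    simp_rw [hG]
    rw [integral_fun_norm_addHaar volume (fun r => G r / r ^ 2), hdim,
      setIntegral_congr_fun measurableSet_Ioi hkeq]
    simp [D, mul_assoc]
  have hq' : q = fun t => (2 * π) ^ (-((m + 3 : ℕ) : ℝ)) * D *
      ∫ r in Set.Ioi (0 : ℝ), sin (t * r) * h r := by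
    ext t
    simp_rw [hq, hG]
    have hheq : ∀ r ∈ Set.Ioi (0 : ℝ),
        r ^ (m + 2) • (sin (t * r) / r * G r) = sin (t * r) * h r := by
      intro r (hr : 0 < r)
      rw [hkh, hk, smul_eq_mul]
      field_simp
      ring
    rw [integral_fun_norm_addHaar volume (fun r => sin (t * r) / r * G r), hdim,
      setIntegral_congr_fun measurableSet_Ioi hheq]
    simp [D, mul_assoc]
  refine ⟨hint, ?_, ?_, fun hne => mul_pos (by positivity) ?_⟩
  · rw [hq']
    exact (h.integrableOn_integral_sin_mul (by simp [hkh])).const_mul _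
  · rw [hq', integral_const_mul, k.integral_integral_sin_mul h hkh, hκ, mul_assoc]
  · obtain ⟨ψ, hψ, hψ0⟩ := exists_schwartzMap_eq_ftransform hσ₂ hσ₂c
    have hnonneg : 0 ≤ fun ξ : Ed (m + 3) => ‖ftransform σ₂ ξ‖ ^ 2 / ‖ξ‖ ^ 2 :=
      fun ξ => by positivity
    refine (integral_nonneg hnonneg).lt_of_ne' fun hz => hne (hψ0 ?_)
    rw [integral_eq_zero_iff_of_nonneg hnonneg hint] at hz
    have hae : ψ =ᵐ[volume] (fun _ => (0 : ℂ)) := by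
      filter_upwards [hz, Measure.ae_ne volume 0] with ξ hξ hξ0
      have : ‖ξ‖ ≠ 0 := norm_ne_zero_iff.2 hξ0
      simpa [hψ, this] using hξ
    ext ξ
    exact congrFun ((ψ.continuous.ae_eq_iff_eq volume continuous_const).1 hae) ξ
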